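/- arXiv:1110.1986 — 2 statements merged into one kernel-verified Lean document; each statement's English description precedes it below -/
import Mathlib

section
/- Let G be a regression graph on node set N and P a probability distribution on a finite product space indexed by N that satisfies the intersection property, the composition property, and all pairwise independences associated with the missing edges of G. Then for all disjoint subsets a, b, c of N: if there is no active path between a and b given c in G, then a ⫫ b | c holds under P. -/
/-- A regression graph on node set `N`: the nodes are partitioned into ordered
connected components (indexed by `comp`), response components coming before
(i.e. having smaller index than) context components; dashed lines join distinct
response nodes in a common component, full lines join distinct context nodes in
a common component, and an arrow `i ⟵ k` (recorded as `arrow i k`) points from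
a node `k` in a strictly later component to a response node `i`. -/
structure RegressionGraph (N : Type) where
  /-- index of the connected component of a node (smaller = earlier) -/
  comp : N → ℕ
  /-- whether a node is a context node -/
  isContext : N → Prop
  /-- dashed lines (joint responses) -/
  dashed : N → N → Prop
  /-- full lines (context variables) -/
  full : N → N → Prop
  /-- `arrow i k` : an arrow `i ⟵ k` pointing from `k` to the response node `i` -/
  arrow : N → N → Prop
  dashed_symm : ∀ i k, dashed i k → dashed k i
  full_symm : ∀ i k, full i k → full k i
  dashed_ne : ∀ i k, dashed i k → i ≠ k
  full_ne : ∀ i k, full i k → i ≠ k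
  dashed_resp : ∀ i k, dashed i k → ¬ isContext i ∧ ¬ isContext k ∧ comp i = comp k
  full_ctx : ∀ i k, full i k → isContext i ∧ isContext k ∧ comp i = comp k
  arrow_resp : ∀ i k, arrow i k → ¬ isContext i ∧ comp i < comp k
  context_last : ∀ i k, ¬ isContext i → isContext k → comp i < comp k

namespace RegressionGraph

variable {N : Type} (G : RegressionGraph N)

/-- Two nodes are adjacent (coupled) if they are joined by one of the three types of edge. -/
def Adj (i k : N) : Prop :=
  G.dashed i k ∨ G.full i k ∨ G.arrow i k ∨ G.arrow k i

/-- The edge between `x` and `o` has an arrowhead at `o`: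
it is an arrow pointing to `o` or a dashed line with endpoint `o`. -/
def ArrowheadAt (x o : N) : Prop := G.arrow o x ∨ G.dashed x o

/-- `q` is anterior to `i`: there is a direction-preserving sequence of arrows
`i ⟵ ... ⟵ p` followed by a sequence of full lines `p — ... — q`
(either part possibly empty). -/
def Anterior (i q : N) : Prop :=
  ∃ p, Relation.ReflTransGen G.arrow i p ∧ Relation.ReflTransGen G.full p q

/-- `ant c`: the nodes outside `c` that are anterior to some node of `c`. -/
def antSet (c : Set N) : Set N := {q | q ∉ c ∧ ∃ i ∈ c, G.Anterior i q}

/-- The inner node `f t` of a path `f 0, f 1, ..., f m` is a collision node: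
both adjacent edges have an arrowhead at it. -/
def IsCollisionAt (f : ℕ → N) (t : ℕ) : Prop :=
  G.ArrowheadAt (f (t - 1)) (f t) ∧ G.ArrowheadAt (f (t + 1)) (f t)

/-- `f 0, f 1, ..., f m` is an active path between `a` and `b` given `c`:
it is a path (distinct nodes, consecutive nodes coupled) with one endpoint in `a`,
the other in `b`, every inner collision node in `c ∪ ant c` and every inner
transmitting node outside `c`. -/
def IsActivePath (a b c : Set N) (f : ℕ → N) (m : ℕ) : Prop :=
  1 ≤ m ∧
  (∀ s ≤ m, ∀ t ≤ m, f s = f t → s = t) ∧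
  (∀ t < m, G.Adj (f t) (f (t + 1))) ∧
  f 0 ∈ a ∧ f m ∈ b ∧
  (∀ t, 0 < t → t < m →
    (G.IsCollisionAt f t → f t ∈ c ∪ G.antSet c) ∧
    (¬ G.IsCollisionAt f t → f t ∉ c))

/-- There is no active path between `a` and `b` given `c`. -/
def ActivePathFree (a b c : Set N) : Prop :=
  ¬ ∃ (f : ℕ → N) (m : ℕ), G.IsActivePath a b c f m

/-- `(i, o, k)` is a collision V-configuration: a three-node path whose endpoints
are uncoupled and whose two edges both have an arrowhead at the inner node `o`. -/
def IsCollisionV (i o k : N) : Prop :=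
  G.Adj i o ∧ G.Adj o k ∧ i ≠ k ∧ ¬ G.Adj i k ∧
    G.ArrowheadAt i o ∧ G.ArrowheadAt k o

/-- `(i, o, k)` is a transmitting V-configuration: a three-node path whose endpoints
are uncoupled which is not a collision V. -/
def IsTransmittingV (i o k : N) : Prop :=
  G.Adj i o ∧ G.Adj o k ∧ i ≠ k ∧ ¬ G.Adj i k ∧
    ¬ (G.ArrowheadAt i o ∧ G.ArrowheadAt k o)

end RegressionGraph

open scoped Classical in
/-- The probability of the event `E` under the (finitely supported) distribution `P`. -/
noncomputable def pr {Ω : Type} [Fintype Ω] (P : Ω → ℝ) (E : Set Ω) : ℝ :=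
  ∑ x, if x ∈ E then P x else 0

/-- `P` is a probability distribution on the finite type `Ω`. -/
def IsProb {Ω : Type} [Fintype Ω] (P : Ω → ℝ) : Prop :=
  (∀ x, 0 ≤ P x) ∧ (∑ x, P x) = 1

/-- The event that the coordinates in `a` take the values prescribed by `y`. -/
def cyl {N : Type} {X : N → Type} (a : Set N) (y : ∀ s, X s) : Set (∀ s, X s) :=
  {x | ∀ s ∈ a, x s = y s}

/-- Conditional independence `a ⫫ b | c` of the sets of coordinate variables `a` and `b`
given `c` under `P`, in product form: for every value `y`,
`P(Y_{a∪b∪c} = y_{a∪b∪c}) ⬝ P(Y_c = y_c) = P(Y_{a∪c} = y_{a∪c}) ⬝ P(Y_{b∪c} = y_{b∪c})`.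
(For `P(Y_c = y_c) > 0` this is the usual factorization of the conditional distribution.) -/
def Indep {N : Type} [Fintype N] [DecidableEq N] {X : N → Type} [∀ s, Fintype (X s)]
    (P : (∀ s, X s) → ℝ) (a b c : Set N) : Prop :=
  ∀ y : ∀ s, X s,
    pr P (cyl (a ∪ b ∪ c) y) * pr P (cyl c y) =
      pr P (cyl (a ∪ c) y) * pr P (cyl (b ∪ c) y)

/-- The intersection property. -/
def HasIntersection {N : Type} [Fintype N] [DecidableEq N] {X : N → Type}
    [∀ s, Fintype (X s)] (P : (∀ s, X s) → ℝ) : Prop :=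
  ∀ a b c d : Set N,
    Disjoint a b → Disjoint a c → Disjoint a d →
    Disjoint b c → Disjoint b d → Disjoint c d →
    Indep P a b (c ∪ d) → Indep P a c (b ∪ d) → Indep P a (b ∪ c) d

/-- The composition property. -/
def HasComposition {N : Type} [Fintype N] [DecidableEq N] {X : N → Type}
    [∀ s, Fintype (X s)] (P : (∀ s, X s) → ℝ) : Prop :=
  ∀ a b c d : Set N,
    Disjoint a b → Disjoint a c → Disjoint a d →
    Disjoint b c → Disjoint b d → Disjoint c d →
    Indep P a b d → Indep P a c d → Indep P a (b ∪ c) d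

/-- Singleton transitivity. -/
def SingletonTransitive {N : Type} [Fintype N] [DecidableEq N] {X : N → Type}
    [∀ s, Fintype (X s)] (P : (∀ s, X s) → ℝ) : Prop :=
  ∀ (i k h : N) (d : Set N),
    i ≠ k → i ≠ h → k ≠ h → i ∉ d → k ∉ d → h ∉ d →
    Indep P {i} {k} d → Indep P {i} {k} (insert h d) →
    (Indep P {i} {h} d ∨ Indep P {k} {h} d)

/-- The nodes in the past of (the component of) `i`: the union `g_{>j}` of the
components strictly after the component `g_j` containing `i`. -/
def pastOf {N : Type} (G : RegressionGraph N) (i : N) : Set N :=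
  {k | G.comp i < G.comp k}

/-- The set `v` of context nodes. -/
def ctxSet {N : Type} (G : RegressionGraph N) : Set N :=
  {k | G.isContext k}

/-- `G` is edge-minimal for `P`: every edge present in `G` corresponds to the conditional
dependence, and every missing edge to the conditional independence, of its node pair,
with the conditioning sets of the pairwise Markov property of a regression graph. -/
def EdgeMinimal {N : Type} [Fintype N] [DecidableEq N] {X : N → Type}
    [∀ s, Fintype (X s)] (G : RegressionGraph N) (P : (∀ s, X s) → ℝ) : Prop :=
  (∀ i k, i ≠ k → ¬ G.isContext i → ¬ G.isContext k → G.comp i = G.comp k →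
    (G.dashed i k → ¬ Indep P {i} {k} (pastOf G i)) ∧
    (¬ G.dashed i k → Indep P {i} {k} (pastOf G i))) ∧
  (∀ i k, ¬ G.isContext i → G.comp i < G.comp k →
    (G.arrow i k → ¬ Indep P {i} {k} (pastOf G i \ {k})) ∧
    (¬ G.arrow i k → Indep P {i} {k} (pastOf G i \ {k}))) ∧
  (∀ i k, i ≠ k → G.isContext i → G.isContext k →
    (G.full i k → ¬ Indep P {i} {k} (ctxSet G \ {i, k})) ∧
    (¬ G.full i k → Indep P {i} {k} (ctxSet G \ {i, k})))

/-- `P` satisfies the pairwise independences associated with the missing edges of `G`. -/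
def PairwiseMarkov {N : Type} [Fintype N] [DecidableEq N] {X : N → Type}
    [∀ s, Fintype (X s)] (G : RegressionGraph N) (P : (∀ s, X s) → ℝ) : Prop :=
  (∀ i k, i ≠ k → ¬ G.isContext i → ¬ G.isContext k → G.comp i = G.comp k →
    ¬ G.dashed i k → Indep P {i} {k} (pastOf G i)) ∧
  (∀ i k, ¬ G.isContext i → G.comp i < G.comp k →
    ¬ G.arrow i k → Indep P {i} {k} (pastOf G i \ {k})) ∧
  (∀ i k, i ≠ k → G.isContext i → G.isContext k →
    ¬ G.full i k → Indep P {i} {k} (ctxSet G \ {i, k}))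

namespace GM

section Prob

variable {N : Type} [Fintype N] [DecidableEq N] {X : N → Type} [∀ s, Fintype (X s)]

theorem pr_nonneg (P : (∀ s, X s) → ℝ) (hP : IsProb P) (E : Set (∀ s, X s)) : 0 ≤ pr P E := by
  unfold pr
  refine Finset.sum_nonneg fun x _ => ?_
  split_ifs
  · exact hP.1 x
  · exact le_refl _

theorem pr_zero_of_subset (P : (∀ s, X s) → ℝ) (hP : IsProb P) {W U : Set N} (h : W ⊆ U)
    (y : ∀ s, X s) (h0 : pr P (cyl W y) = 0) : pr P (cyl U y) = 0 := by
  refine le_antisymm ?_ (pr_nonneg P hP _)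
  rw [← h0]
  unfold pr
  refine Finset.sum_le_sum fun x _ => ?_
  by_cases h1 : x ∈ cyl U y
  · have h2 : x ∈ cyl W y := fun s hs => h1 s (h hs)
    rw [if_pos h1, if_pos h2]
  · rw [if_neg h1]
    split_ifs
    · exact hP.1 x
    · exact le_refl _

theorem cyl_update {W : Set N} {s : N} (hs : s ∉ W) (y : ∀ s, X s) (v : X s) :
    cyl W (Function.update y s v) = cyl W y := by
  ext x
  constructor
  · intro h w hw
    have := h w hw
    rwa [Function.update_of_ne (by rintro rfl; exact hs hw)] at this
  · intro h w hw
    rw [Function.update_of_ne (by rintro rfl; exact hs hw)]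
    exact h w hw

theorem pr_sum (P : (∀ s, X s) → ℝ) {W : Set N} {s : N} (hs : s ∉ W) (y : ∀ s, X s) :
    pr P (cyl W y) = ∑ v : X s, pr P (cyl (insert s W) (Function.update y s v)) := by
  classical
  unfold pr
  rw [Finset.sum_comm]
  refine Finset.sum_congr rfl fun x _ => ?_
  have h : ∀ v : X s, (x ∈ cyl (insert s W) (Function.update y s v)) ↔
      (x s = v ∧ x ∈ cyl W y) := by
    intro v
    rw [← cyl_update hs y v]
    constructor
    · intro h
      refine ⟨?_, fun w hw => h w (Or.inr hw)⟩
      have := h s (Or.inl rfl)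
      rwa [Function.update_self] at this
    · rintro ⟨h1, h2⟩ w hw
      rcases hw with rfl | hw
      · rw [Function.update_self]; exact h1
      · exact h2 w hw
  simp only [h]
  by_cases hx : x ∈ cyl W y
  · simp [hx]
  · simp [hx]

theorem indep_symm {P : (∀ s, X s) → ℝ} {a b c : Set N} (h : Indep P a b c) : Indep P b a c := by
  intro y
  have := h y
  rw [Set.union_comm b a, this, mul_comm]

theorem indep_drop {P : (∀ s, X s) → ℝ} {a b c : Set N} {s : N} (ha : s ∉ a) (hb : s ∉ b)
    (hc : s ∉ c) (h : Indep P a (insert s b) c) : Indep P a b c := by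
  intro y
  have e1 : a ∪ insert s b ∪ c = insert s (a ∪ b ∪ c) := by ext; simp; tauto
  have e2 : insert s b ∪ c = insert s (b ∪ c) := by ext; simp; tauto
  have hs1 : s ∉ a ∪ b ∪ c := by simp [ha, hb, hc]
  have hs2 : s ∉ b ∪ c := by simp [hb, hc]
  have hs3 : s ∉ a ∪ c := by simp [ha, hc]
  rw [pr_sum P hs1, pr_sum P hs2, Finset.sum_mul, Finset.mul_sum]
  refine Finset.sum_congr rfl fun v _ => ?_
  have := h (Function.update y s v)
  rwa [e1, e2, cyl_update hc, cyl_update hs3] at this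

theorem indep_decomp {P : (∀ s, X s) → ℝ} {a b c d : Set N} (hab : Disjoint a (b ∪ d))
    (hbd : Disjoint b d) (hc : Disjoint (b ∪ d) c) (h : Indep P a (b ∪ d) c) : Indep P a b c := by
  have hd : d.Finite := Set.toFinite d
  induction d, hd using Set.Finite.induction_on with
  | empty => simpa using h
  | @insert s d hs _ ih =>
    rw [Set.disjoint_left] at hab hbd hc
    have e : b ∪ insert s d = insert s (b ∪ d) := by ext; simp
    rw [e] at h
    refine ih ?_ ?_ ?_ (indep_drop ?_ ?_ ?_ h)
    · rw [Set.disjoint_left]; intro x hx hx'; exact hab hx (by simp at hx' ⊢; tauto)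
    · rw [Set.disjoint_left]; intro x hx hx'; exact hbd hx (by simp at hx' ⊢; tauto)
    · rw [Set.disjoint_left]; intro x hx hx'; exact hc (by simp at hx ⊢; tauto) hx'
    · intro hx; exact hab hx (by simp)
    · intro hx
      rcases hx with hx | hx
      · exact hbd hx (by simp)
      · exact hs hx
    · intro hx; exact hc (by simp) hx

theorem indep_weak {P : (∀ s, X s) → ℝ} (hP : IsProb P) {a b c d : Set N}
    (hab : Disjoint a (b ∪ d))
    (hbd : Disjoint b d) (hc : Disjoint (b ∪ d) c) (h : Indep P a (b ∪ d) c) :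
    Indep P a b (c ∪ d) := by
  have h2 : Indep P a d c := by
    rw [Set.union_comm] at hab hc h
    exact indep_decomp hab hbd.symm hc h
  intro y
  have e1 := h y
  have e2 := h2 y
  have s1 : a ∪ (b ∪ d) ∪ c = a ∪ b ∪ (c ∪ d) := by ext; simp; tauto
  have s2 : b ∪ d ∪ c = b ∪ (c ∪ d) := by ext; simp; tauto
  have s3 : a ∪ d ∪ c = a ∪ (c ∪ d) := by ext; simp; tauto
  have s4 : d ∪ c = c ∪ d := by ext; simp; tauto
  rw [s1, s2] at e1
  rw [s3, s4] at e2
  by_cases h0 : pr P (cyl c y) = 0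
  · rw [pr_zero_of_subset P hP (U := a ∪ b ∪ (c ∪ d)) (by intro x; simp; tauto) y h0,
      pr_zero_of_subset P hP (U := b ∪ (c ∪ d)) (by intro x; simp; tauto) y h0]
    simp
  · apply mul_right_cancel₀ h0
    linear_combination (pr P (cyl (c ∪ d) y)) * e1 - (pr P (cyl (b ∪ (c ∪ d)) y)) * e2

theorem indep_contr {P : (∀ s, X s) → ℝ} (hP : IsProb P) {a b c d : Set N}
    (h1 : Indep P a d c) (h2 : Indep P a b (c ∪ d)) : Indep P a (b ∪ d) c := by
  intro y
  have e2 := h1 y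
  have e1 := h2 y
  have s1 : a ∪ (b ∪ d) ∪ c = a ∪ b ∪ (c ∪ d) := by ext; simp; tauto
  have s2 : b ∪ d ∪ c = b ∪ (c ∪ d) := by ext; simp; tauto
  have s3 : a ∪ d ∪ c = a ∪ (c ∪ d) := by ext; simp; tauto
  have s4 : d ∪ c = c ∪ d := by ext; simp; tauto
  rw [s1, s2]
  rw [s3, s4] at e2
  by_cases h0 : pr P (cyl (c ∪ d) y) = 0
  · rw [pr_zero_of_subset P hP (U := a ∪ b ∪ (c ∪ d)) (by intro x; simp; tauto) y h0,
      pr_zero_of_subset P hP (U := b ∪ (c ∪ d)) (by intro x; simp; tauto) y h0]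
    simp
  · apply mul_right_cancel₀ h0
    linear_combination (pr P (cyl c y)) * e1 + (pr P (cyl (b ∪ (c ∪ d)) y)) * e2

/-- Independence bundled with disjointness. -/
def J (P : (∀ s, X s) → ℝ) (a b c : Set N) : Prop :=
  Disjoint a b ∧ Disjoint a c ∧ Disjoint b c ∧ Indep P a b c

variable {P : (∀ s, X s) → ℝ}

theorem J.symm {a b c : Set N} (h : J P a b c) : J P b a c :=
  ⟨h.1.symm, h.2.2.1, h.2.1, indep_symm h.2.2.2⟩

/-- one-sided monotonicity -/
theorem J.mono1 (hP : IsProb P) {a b c b' c' : Set N} (h : J P a b c) (hb : b' ⊆ b)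
    (hc : c ⊆ c') (hc' : c' ⊆ b ∪ c) (hd : Disjoint b' c') : J P a b' c' := by
  obtain ⟨h1, h2, h3, h4⟩ := h
  have e1 : b = (b' ∪ c' ∩ b) ∪ (b \ (b' ∪ c')) := by
    ext x; have := @hb x; simp; tauto
  rw [Set.disjoint_left] at h1 h2 h3 hd
  have k1 : Indep P a (b' ∪ c' ∩ b) c := by
    refine indep_decomp (d := b \ (b' ∪ c')) ?_ ?_ ?_ (by rwa [← e1])
    · rw [← e1, Set.disjoint_left]; exact h1
    · rw [Set.disjoint_left]; intro x; simp; tauto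
    · rw [← e1, Set.disjoint_left]; exact h3
  have k2 : Indep P a b' (c ∪ c' ∩ b) := by
    refine indep_weak hP ?_ ?_ ?_ k1 <;> rw [Set.disjoint_left] <;> intro x <;>
      have := @hb x <;> have := @h1 x <;> have := @h3 x <;> have := @hd x <;> simp <;> tauto
  have e2 : c ∪ c' ∩ b = c' := by
    ext x; have := @hc x; have := @hc' x; simp at *; tauto
  rw [e2] at k2
  refine ⟨?_, ?_, ?_, k2⟩ <;> rw [Set.disjoint_left] <;> intro x <;>
      have := @hb x <;> have := @h1 x <;> have := @h2 x <;> have := @h3 x <;> have := @hd x <;>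
      have := @hc x <;> have := @hc' x <;> simp at * <;> tauto

theorem J.mono (hP : IsProb P) {a b c a' b' c' : Set N} (h : J P a b c) (ha : a' ⊆ a) (hb : b' ⊆ b)
    (hc : c ⊆ c') (hc' : c' ⊆ a ∪ b ∪ c) (hda : Disjoint a' c') (hd : Disjoint b' c') :
    J P a' b' c' := by
  obtain ⟨h1, h2, h3, h4⟩ := id h
  rw [Set.disjoint_left] at h1 h2 h3 hd hda
  have k1 : J P a b' (c' \ a) := by
    refine h.mono1 hP hb ?_ ?_ ?_ <;> try rw [Set.disjoint_left]
    all_goals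
      intro x
      have := @hb x; have := @h1 x; have := @h2 x; have := @h3 x; have := @hd x
      have := @hc x; have := @hc' x; simp at *; tauto
  refine (k1.symm.mono1 hP ha ?_ ?_ ?_).symm <;> try rw [Set.disjoint_left]
  all_goals
    intro x
    have := @hda x; have := @hd x
    first | tauto | (simp only [Set.mem_union, Set.mem_sdiff]; tauto)

theorem J.contr (hP : IsProb P) {a b c d e : Set N} (h1 : J P a d c) (h2 : J P a b e)
    (he : e = c ∪ d) : J P a (b ∪ d) c := by
  subst he
  obtain ⟨p1, p2, p3, p4⟩ := h1
  obtain ⟨q1, q2, q3, q4⟩ := h2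
  refine ⟨?_, p2, ?_, indep_contr hP p4 q4⟩
  · simp [p1, q1]
  · simp at q3; simp [q3, p3]

theorem J.inter (hi : HasIntersection P) {a b c d e f : Set N} (h1 : J P a b e) (h2 : J P a c f)
    (he : e = c ∪ d) (hf : f = b ∪ d) : J P a (b ∪ c) d := by
  subst he hf
  obtain ⟨p1, p2, p3, p4⟩ := h1
  obtain ⟨q1, q2, q3, q4⟩ := h2
  simp only [Set.disjoint_union_right] at *
  refine ⟨?_, p2.2, ?_, hi a b c d p1 q1 p2.2 p3.1 p3.2 q3.2 p4 q4⟩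
  · simp [p1, q1]
  · simp [p3, q3]

theorem J.comp (hP : IsProb P) (hc : HasComposition P) {a b c d : Set N} (h1 : J P a b d)
    (h2 : J P a c d) : J P a (b ∪ c) d := by
  have h3 : J P a (c \ b) d := by
    refine h2.mono1 hP Set.diff_subset (le_refl _) Set.subset_union_right ?_
    exact h2.2.2.1.mono_left Set.diff_subset
  rw [← Set.union_diff_self]
  obtain ⟨p1, p2, p3, p4⟩ := h1
  obtain ⟨q1, q2, q3, q4⟩ := h3
  refine ⟨?_, p2, ?_, hc a b (c \ b) d p1 q1 p2 Set.disjoint_sdiff_right p3 q3 p4 q4⟩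
  · simp only [Set.disjoint_union_right]; exact ⟨p1, q1⟩
  · simp only [Set.disjoint_union_left]; exact ⟨p3, q3⟩

theorem J.empty {a c : Set N} (h : Disjoint a c) : J P a ∅ c := by
  refine ⟨by simp, h, by simp, ?_⟩
  intro y
  simp

theorem J.compAll (hP : IsProb P) (hc : HasComposition P) {a b c : Set N} (h : Disjoint a c)
    (hb : ∀ x ∈ b, J P a {x} c) : J P a b c := by
  have hf : b.Finite := Set.toFinite b
  induction b, hf using Set.Finite.induction_on with
  | empty => exact J.empty h
  | @insert s d hs _ ih =>
    rw [Set.insert_eq]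
    exact J.comp hP hc (hb s (by simp)) (ih fun x hx => hb x (by simp [hx]))

theorem J.interAll (hi : HasIntersection P) {a b c : Set N} (h : Disjoint a b)
    (hac : Disjoint a c) (hbc : Disjoint b c)
    (hb : ∀ x ∈ b, J P a {x} ((b ∪ c) \ {x})) : J P a b c := by
  have key : ∀ d : Set N, d ⊆ b → J P a d ((b ∪ c) \ d) := by
    intro d hd
    have hf : d.Finite := Set.toFinite d
    induction d, hf using Set.Finite.induction_on with
    | empty =>
      apply J.empty
      simp [h, hac]
    | @insert s d hs _ ih =>
      rw [Set.insert_eq]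
      have hs' : s ∈ b := hd (by simp)
      have hd' : d ⊆ b := fun x hx => hd (by simp [hx])
      refine J.inter hi (hb s hs') (ih hd') ?_ ?_
      · ext x; have := @hd' x; by_cases hx : x = s
        · subst hx; simp; tauto
        · simp; tauto
      · ext x; by_cases hx : x = s
        · subst hx; simp; tauto
        · simp; tauto
  have := key b (le_refl _)
  rw [Set.disjoint_left] at hbc
  have e : (b ∪ c) \ b = c := by ext x; have := @hbc x; simp; tauto
  rwa [e] at this

theorem J.interPairs (hi : HasIntersection P) {a b c : Set N} (h : Disjoint a b)
    (hac : Disjoint a c) (hbc : Disjoint b c)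
    (hb : ∀ i ∈ a, ∀ k ∈ b, J P {i} {k} ((a ∪ b ∪ c) \ {i, k})) : J P a b c := by
  refine J.interAll hi h hac hbc fun k hk => ?_
  rw [Set.disjoint_left] at h hac hbc
  refine (J.interAll hi ?_ ?_ ?_ fun i hia => ?_).symm
  · simp; intro hh; exact h hh hk
  · simp
  · rw [Set.disjoint_left]; intro x hx
    have := h hx; have := hac hx; simp; tauto
  · have := (hb i hia k hk).symm
    convert this using 1
    have hik : i ≠ k := by rintro rfl; exact h hia hk
    ext x; have := h hia; have := hac hia; have := @h k; have := hbc hk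
    by_cases hx : x = k
    · subst hx; simp; tauto
    · simp; tauto

end Prob

section Graph

variable {N : Type} (G : RegressionGraph N)

/-- anterior closure -/
def An (c : Set N) : Set N := {q | ∃ i ∈ c, G.Anterior i q}

theorem union_antSet (c : Set N) : c ∪ G.antSet c = An G c := by
  ext q
  simp only [Set.mem_union, RegressionGraph.antSet, An, Set.mem_setOf_eq]
  constructor
  · rintro (h | h)
    · exact ⟨q, h, q, .refl, .refl⟩
    · exact h.2
  · intro h
    by_cases hq : q ∈ c
    · exact Or.inl hq
    · exact Or.inr ⟨hq, h⟩

theorem subset_An (c : Set N) : c ⊆ An G c := fun q h => ⟨q, h, q, .refl, .refl⟩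

theorem full_rtg {p q : N} (hq : ¬ G.isContext q) (h : Relation.ReflTransGen G.full p q) :
    p = q := by
  cases h with
  | refl => rfl
  | tail _ h => exact absurd (G.full_ctx _ _ h).2.1 hq

theorem An_arrow {c : Set N} {q p : N} (hq : q ∈ An G c) (h : G.arrow q p) : p ∈ An G c := by
  obtain ⟨i, hi, r, h1, h2⟩ := hq
  have := full_rtg G (G.arrow_resp _ _ h).1 h2
  subst this
  exact ⟨i, hi, p, h1.tail h, .refl⟩

theorem An_full {c : Set N} {q p : N} (hq : q ∈ An G c) (h : G.full q p) : p ∈ An G c := by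
  obtain ⟨i, hi, r, h1, h2⟩ := hq
  exact ⟨i, hi, r, h1, h2.tail h⟩

theorem head_resp {x o : N} (h : G.ArrowheadAt x o) : ¬ G.isContext o := by
  rcases h with h | h
  · exact (G.arrow_resp _ _ h).1
  · exact (G.dashed_resp _ _ h).2.1

theorem not_head_of_arrow {z o : N} (h : G.arrow z o) : ¬ G.ArrowheadAt z o := by
  rintro (h' | h')
  · have := (G.arrow_resp _ _ h).2; have := (G.arrow_resp _ _ h').2; omega
  · have := (G.arrow_resp _ _ h).2; have := (G.dashed_resp _ _ h').2.2; omega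

/-- if the edge `o - x` has no arrowhead at the response node `o`, it is an arrow to `x` -/
theorem arrow_of_tail {o x : N} (ho : ¬ G.isContext o) (h : G.Adj o x)
    (ht : ¬ G.ArrowheadAt x o) : G.arrow x o := by
  rcases h with h | h | h | h
  · exact absurd (Or.inr (G.dashed_symm _ _ h)) ht
  · exact absurd (G.full_ctx _ _ h).1 ho
  · exact absurd (Or.inl h) ht
  · exact h

theorem adj_symm {x y : N} (h : G.Adj x y) : G.Adj y x := by
  rcases h with h | h | h | h
  · exact Or.inl (G.dashed_symm _ _ h)
  · exact Or.inr (Or.inl (G.full_symm _ _ h))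
  · exact Or.inr (Or.inr (Or.inr h))
  · exact Or.inr (Or.inr (Or.inl h))

/-- walks from `a` with colliders in `Z` and non-colliders outside `c` -/
inductive Reach (a c Z : Set N) : N → Prop → Prop
  | start (x : N) (hx : x ∈ a) : Reach a c Z x False
  | step (o o' : N) (h : Prop) (hr : Reach a c Z o h) (hadj : G.Adj o o')
      (h1 : h ∧ G.ArrowheadAt o' o → o ∈ Z) (h2 : ¬ (h ∧ G.ArrowheadAt o' o) → o ∉ c) :
      Reach a c Z o' (G.ArrowheadAt o o')

theorem reach_up {a c : Set N} {x o : N} (hx : x ∈ a) (h : Relation.ReflTransGen G.arrow x o)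
    (ho : o ∉ An G c) : ∃ h, ¬ h ∧ Reach G a c (An G c) o h := by
  induction h with
  | refl => exact ⟨False, id, .start _ hx⟩
  | @tail z o _ hzo ih =>
    have hz : z ∉ An G c := fun hz => ho (An_arrow G hz hzo)
    obtain ⟨h, hn, hr⟩ := ih hz
    refine ⟨_, not_head_of_arrow G hzo, .step z o h hr (Or.inr (Or.inr (Or.inl hzo))) ?_ ?_⟩
    · exact fun hh => absurd hh.1 hn
    · exact fun _ hc => hz (subset_An G c hc)

theorem reach_down {a b c : Set N} {y o : N} (hy : y ∈ b)
    (h : Relation.ReflTransGen G.arrow y o)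
    (ho : o ∉ An G c) (p : Prop) (hr : Reach G a c (An G c) o p) :
    ∃ y ∈ b, ∃ h, Reach G a c (An G c) y h := by
  induction h generalizing p with
  | refl => exact ⟨y, hy, p, hr⟩
  | @tail z o _ hzo ih =>
    have hz : z ∉ An G c := fun hz => ho (An_arrow G hz hzo)
    refine ih hz _ (.step o z p hr (Or.inr (Or.inr (Or.inr hzo))) ?_ ?_)
    · exact fun hh => absurd hh.2 (not_head_of_arrow G hzo)
    · exact fun _ hc => ho (subset_An G c hc)

theorem weak_to_active {a b c : Set N} {x : N} {p : Prop}
    (h : Reach G a c (An G (a ∪ b ∪ c)) x p) :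
    (∃ y ∈ b, ∃ h, Reach G a c (An G c) y h) ∨ Reach G a c (An G c) x p := by
  induction h with
  | start x hx => exact Or.inr (.start x hx)
  | step o o' h hr hadj h1 h2 ih =>
    rcases ih with ih | ih
    · exact Or.inl ih
    by_cases hcol : h ∧ G.ArrowheadAt o' o
    · by_cases hoc : o ∈ An G c
      · exact Or.inr (.step o o' h ih hadj (fun _ => hoc) h2)
      have hoc' : o ∉ c := fun hc => hoc (subset_An G c hc)
      obtain ⟨i, hi, r, e1, e2⟩ := h1 hcol
      have := full_rtg G (head_resp G hcol.2) e2
      subst this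
      rcases hi with (hi | hi) | hi
      · obtain ⟨p, hp, hr'⟩ := reach_up G hi e1 hoc
        exact Or.inr (.step r o' p hr' hadj (fun hh => absurd hh.1 hp) (fun _ => hoc'))
      · exact Or.inl (reach_down G hi e1 hoc _ ih)
      · exact absurd ⟨i, hi, r, e1, .refl⟩ hoc
    · exact Or.inr (.step o o' h ih hadj (fun hh => absurd hh hcol) h2)

/-- active walk -/
def Walk (a b c Z : Set N) (f : ℕ → N) (m : ℕ) : Prop :=
  (∀ t < m, G.Adj (f t) (f (t + 1))) ∧
  f 0 ∈ a ∧ f m ∈ b ∧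
  (∀ t, 0 < t → t < m →
    (G.IsCollisionAt f t → f t ∈ Z) ∧
    (¬ G.IsCollisionAt f t → f t ∉ c))

theorem walk_of_reach {a c Z : Set N} {x : N} {p : Prop} (h : Reach G a c Z x p) :
    ∃ f m, Walk G a {x} c Z f m ∧ (1 ≤ m → (p ↔ G.ArrowheadAt (f (m - 1)) (f m))) := by
  induction h with
  | start x hx =>
    exact ⟨fun _ => x, 0, ⟨by simp, hx, by simp, by intro t h1 h2; omega⟩, by simp⟩
  | step o o' h hr hadj h1 h2 ih =>
    obtain ⟨f, m, ⟨w1, w2, w3, w4⟩, hh⟩ := ih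
    have w3 : f m = o := w3
    let g : ℕ → N := fun u => if u ≤ m then f u else o'
    have hg : ∀ u ≤ m, g u = f u := fun u hu => if_pos hu
    have hg' : g (m + 1) = o' := if_neg (by omega)
    refine ⟨g, m + 1, ⟨?_, ?_, ?_, ?_⟩, ?_⟩
    · intro t ht
      by_cases htm : t = m
      · subst htm; rw [hg', hg _ le_rfl, w3]; exact hadj
      · rw [hg _ (by omega), hg _ (by omega)]; exact w1 t (by omega)
    · rw [hg _ (by omega)]; exact w2
    · exact hg'
    · intro t ht0 htm
      by_cases hm : t = m
      · subst hm
        unfold RegressionGraph.IsCollisionAt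
        rw [hg', hg _ le_rfl, hg _ (by omega), ← hh ht0, w3]
        exact ⟨h1, h2⟩
      · have := w4 t ht0 (by omega)
        unfold RegressionGraph.IsCollisionAt at this ⊢
        rw [hg _ (by omega), hg _ (by omega), hg _ (by omega)]
        exact this
    · intro _
      rw [hg', Nat.add_sub_cancel, hg _ le_rfl, w3]

theorem walk_cut {a b c : Set N} {f : ℕ → N} {m : ℕ} (hw : Walk G a b c (An G c) f m)
    {s t : ℕ} (hst : s < t) (htm : t ≤ m) (he : f s = f t) :
    ∃ g, Walk G a b c (An G c) g (m - (t - s)) := by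
  obtain ⟨w1, w2, w3, w4⟩ := hw
  let g : ℕ → N := fun u => if u ≤ s then f u else f (u + (t - s))
  have g1 : ∀ u ≤ s, g u = f u := fun u hu => if_pos hu
  have g2 : ∀ u, s ≤ u → g u = f (u + (t - s)) := by
    intro u hu
    by_cases h : u = s
    · subst h; rw [g1 _ le_rfl, he]; congr 1; omega
    · exact if_neg (by omega)
  refine ⟨g, ?_, ?_, ?_, ?_⟩
  · intro u hu
    by_cases h : u < s
    · rw [g1 _ (by omega), g1 _ (by omega)]; exact w1 u (by omega)
    · rw [g2 _ (by omega), g2 _ (by omega)]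
      have := w1 (u + (t - s)) (by omega)
      rwa [show u + (t - s) + 1 = u + 1 + (t - s) by omega] at this
  · rw [g1 _ (by omega)]; exact w2
  · rw [g2 _ (by omega), show m - (t - s) + (t - s) = m by omega]; exact w3
  · intro u hu0 hum
    unfold RegressionGraph.IsCollisionAt at w4 ⊢
    rcases lt_trichotomy u s with h | h | h
    · rw [g1 _ (by omega), g1 _ (by omega), g1 _ (by omega)]
      exact w4 u hu0 (by omega)
    · subst h
      have ws := w4 u hu0 (by omega)
      have wt := w4 t (by omega) (by omega)
      rw [g1 (u - 1) (by omega), g1 u le_rfl, g2 (u + 1) (by omega),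
        show u + 1 + (t - u) = t + 1 by omega]
      rw [← he] at wt
      constructor
      · rintro ⟨c1, c2⟩
        by_contra hZ
        have key : ∀ d, u + d + 1 ≤ t →
            G.arrow (f (u + d + 1)) (f (u + d)) ∧ f (u + d) ∉ An G c ∧
              G.comp (f (u + d + 1)) < G.comp (f u) := by
          intro d
          induction d with
          | zero =>
            intro _
            have : G.arrow (f (u + 1)) (f u) := by
              refine arrow_of_tail G (head_resp G c1) (w1 u (by omega)) ?_
              intro hh
              exact hZ (ws.1 ⟨c1, hh⟩)
            exact ⟨this, hZ, (G.arrow_resp _ _ this).2⟩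
          | succ d ih =>
            intro hd
            obtain ⟨i1, i2, i3⟩ := ih (by omega)
            have hn : f (u + d + 1) ∉ An G c := fun hh => i2 (An_arrow G hh i1)
            have ww := w4 (u + d + 1) (by omega) (by omega)
            have : G.arrow (f (u + d + 1 + 1)) (f (u + d + 1)) := by
              refine arrow_of_tail G (G.arrow_resp _ _ i1).1 (w1 _ (by omega)) ?_
              intro hh
              refine hn (ww.1 ⟨Or.inl ?_, hh⟩)
              simpa using i1
            exact ⟨this, hn, lt_trans (G.arrow_resp _ _ this).2 i3⟩
        have := (key (t - u - 1) (by omega)).2.2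
        rw [show u + (t - u - 1) + 1 = t by omega, he] at this
        exact lt_irrefl _ this
      · intro hn hc
        apply hn
        constructor
        · by_contra h'
          exact ws.2 (fun hh => h' hh.1) hc
        · by_contra h'
          exact wt.2 (fun hh => h' hh.2) hc
    · rw [g2 _ (by omega), g2 _ (by omega), g2 _ (by omega)]
      have := w4 (u + (t - s)) (by omega) (by omega)
      rwa [show u + (t - s) - 1 = u - 1 + (t - s) by omega,
        show u + (t - s) + 1 = u + 1 + (t - s) by omega] at this

theorem path_of_walk {a b c : Set N} (hab : Disjoint a b)
    (h : ∃ m f, Walk G a b c (An G c) f m) : ∃ f m, G.IsActivePath a b c f m := by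
  classical
  obtain ⟨f, hf⟩ := Nat.find_spec h
  refine ⟨f, Nat.find h, ?_⟩
  have hmin : ∀ s t, s < t → t ≤ Nat.find h → f s ≠ f t := by
    intro s t hst htm he
    have := walk_cut G hf hst htm he
    exact Nat.find_min h (by omega) this
  refine ⟨?_, ?_, hf.1, hf.2.1, hf.2.2.1, ?_⟩
  · by_contra h0
    have h0 : Nat.find h = 0 := by omega
    have h1 := hf.2.1
    have h2 := hf.2.2.1
    rw [h0] at h2
    exact Set.disjoint_left.1 hab h1 h2
  · intro s hs t ht he
    by_contra hne
    rcases lt_or_gt_of_ne hne with h1 | h1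
    · exact hmin s t h1 ht he
    · exact hmin t s h1 hs he.symm
  · rw [union_antSet]; exact hf.2.2.2

/-- dashed connectivity within `A` -/
def Conn (A : Set N) : N → N → Prop :=
  Relation.ReflTransGen fun x y => G.dashed x y ∧ x ∈ A ∧ y ∈ A

/-- collider-connectedness within `A` -/
def CC (A : Set N) (i k : N) : Prop :=
  G.full i k ∨ ∃ o ∈ A, ∃ o' ∈ A, Conn G A o o' ∧ (o = i ∨ G.arrow o i) ∧ (o' = k ∨ G.arrow o' k)

theorem conn_symm {A : Set N} {x y : N} (h : Conn G A x y) : Conn G A y x := by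
  induction h with
  | refl => exact .refl
  | tail _ h ih => exact Relation.ReflTransGen.head ⟨G.dashed_symm _ _ h.1, h.2.2, h.2.1⟩ ih

theorem cc_symm {A : Set N} {i k : N} (h : CC G A i k) : CC G A k i := by
  rcases h with h | ⟨o, ho, o', ho', h1, h2, h3⟩
  · exact Or.inl (G.full_symm _ _ h)
  · exact Or.inr ⟨o', ho', o, ho, conn_symm G h1, h3, h2⟩

theorem reach_cc {a c A : Set N} {i k : N} (hi : ∃ h, Reach G a c A i h) (hiA : i ∈ A)
    (hic : i ∉ c) (h : CC G A i k) : ∃ h, Reach G a c A k h := by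
  obtain ⟨p, hp⟩ := hi
  rcases h with h | ⟨o, ho, o', ho', h1, h2, h3⟩
  · exact ⟨_, .step i k p hp (Or.inr (Or.inl h)) (fun _ => hiA) (fun _ => hic)⟩
  · have base : ∃ q, Reach G a c A o q ∧ o ∈ A ∧ (q ∨ o ∉ c) := by
      rcases h2 with rfl | h2
      · exact ⟨p, hp, hiA, Or.inr hic⟩
      · exact ⟨_, .step i o p hp (Or.inr (Or.inr (Or.inr h2))) (fun _ => hiA) (fun _ => hic),
          ho, Or.inl (Or.inl h2)⟩
    have hstep : ∀ z z', (∃ q, Reach G a c A z q ∧ z ∈ A ∧ (q ∨ z ∉ c)) → G.Adj z z' →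
        G.ArrowheadAt z' z → Reach G a c A z' (G.ArrowheadAt z z') := by
      rintro z z' ⟨q, hq, hz, hqc⟩ hadj hhead
      refine .step z z' q hq hadj (fun _ => hz) (fun hn => ?_)
      rcases hqc with hqc | hqc
      · exact absurd ⟨hqc, hhead⟩ hn
      · exact hqc
    have main : ∃ q, Reach G a c A o' q ∧ o' ∈ A ∧ (q ∨ o' ∉ c) := by
      clear h3 ho'
      induction h1 with
      | refl => exact base
      | @tail y z _ hz ih =>
        exact ⟨_, hstep y z ih (Or.inl hz.1) (Or.inr (G.dashed_symm _ _ hz.1)), hz.2.2,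
          Or.inl (Or.inr hz.1)⟩
    rcases h3 with rfl | h3
    · exact ⟨_, main.choose_spec.1⟩
    · exact ⟨_, hstep o' k main (Or.inr (Or.inr (Or.inl h3))) (Or.inl h3)⟩

end Graph

section Main

variable {N : Type} [Fintype N] [DecidableEq N] {X : N → Type} [∀ s, Fintype (X s)]
  {G : RegressionGraph N} {P : (∀ s, X s) → ℝ}

theorem ctx_local (hpm : PairwiseMarkov G P) (hint : HasIntersection P) {i : N}
    (hi : G.isContext i) :
    J P {i} {x | G.isContext x ∧ x ≠ i ∧ ¬ G.full i x} {x | G.full i x} := by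
  have hne := G.full_ne i
  have hctx := G.full_ctx i
  refine J.interPairs hint ?_ ?_ ?_ ?_
  · simp
  · simp; intro h; exact hne i h rfl
  · rw [Set.disjoint_left]; intro x; simp
  · rintro j hj k ⟨h1, h2, h3⟩
    have hj : j = i := hj
    subst hj
    have := hpm.2.2 j k (Ne.symm h2) hi h1 h3
    have e : (({j} ∪ {x | G.isContext x ∧ x ≠ j ∧ ¬ G.full j x} ∪ {x | G.full j x}) \ {j, k}
        : Set N) = ctxSet G \ {j, k} := by
      ext x
      have := hctx x
      simp [ctxSet]
      grind
    rw [e]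
    refine ⟨?_, ?_, ?_, this⟩
    · simp; exact fun h => h2 h.symm
    · simp
    · simp

theorem resp_local (hpm : PairwiseMarkov G P) (hint : HasIntersection P) {i : N}
    (hi : ¬ G.isContext i) :
    J P {i} {x | G.comp i < G.comp x ∧ ¬ G.arrow i x} {x | G.arrow i x} := by
  have harr := G.arrow_resp i
  refine J.interPairs hint ?_ ?_ ?_ ?_
  · simp
  · simp; intro h; have := (harr i h).2; omega
  · rw [Set.disjoint_left]; intro x; simp
  · rintro j hj k ⟨h1, h3⟩
    have hj : j = i := hj
    subst hj
    have := hpm.2.1 j k hi h1 h3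
    have e : (({j} ∪ {x | G.comp j < G.comp x ∧ ¬ G.arrow j x} ∪ {x | G.arrow j x}) \ {j, k}
        : Set N) = pastOf G j \ {k} := by
      ext x
      have := harr x
      simp [pastOf]
      grind
    rw [e]
    refine ⟨?_, ?_, ?_, this⟩
    · simp; rintro rfl; omega
    · simp [pastOf]
    · simp

/-- block statement for a subset of one response component -/
theorem block (hP : IsProb P) (hpm : PairwiseMarkov G P) (hint : HasIntersection P)
    (hcomp : HasComposition P) {n : ℕ} {S T : Set N}
    (hS : ∀ x ∈ S, ¬ G.isContext x ∧ G.comp x = n) (hT : ∀ x ∈ T, ¬ G.isContext x ∧ G.comp x = n)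
    (hST : Disjoint S T) (hd : ∀ x ∈ S, ∀ y ∈ T, ¬ G.dashed x y) :
    J P S (T ∪ {k | n < G.comp k ∧ ∀ x ∈ S, ¬ G.arrow x k}) {k | ∃ x ∈ S, G.arrow x k} := by
  have harr := G.arrow_resp
  have dS : Disjoint S {k | ∃ x ∈ S, G.arrow x k} := by
    rw [Set.disjoint_left]
    rintro x hx ⟨y, hy, hxy⟩
    have := (harr _ _ hxy).2
    have := (hS x hx).2
    have := (hS y hy).2
    omega
  have h1 : J P S {k | n < G.comp k ∧ ∀ x ∈ S, ¬ G.arrow x k} {k | ∃ x ∈ S, G.arrow x k} := by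
    refine (J.compAll hP hcomp ?_ fun x hx => ?_).symm
    · rw [Set.disjoint_left]
      rintro k ⟨_, hk⟩ ⟨x, hx, hxk⟩
      exact hk x hx hxk
    · have h0 := resp_local hpm hint (hS x hx).1
      refine (h0.mono hP (le_refl _) ?_ ?_ ?_ ?_ ?_).symm
      · rintro k ⟨hk1, hk2⟩
        exact ⟨by rw [(hS x hx).2]; exact hk1, hk2 x hx⟩
      · intro k hk; exact ⟨x, hx, hk⟩
      · rintro k ⟨y, hy, hk⟩
        have := (harr _ _ hk).2
        have := (hS x hx).2
        have := (hS y hy).2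
        simp only [Set.mem_union, Set.mem_singleton_iff, Set.mem_setOf_eq]
        by_cases hxk : G.arrow x k
        · exact Or.inr hxk
        · exact Or.inl (Or.inr ⟨by omega, hxk⟩)
      · simp only [Set.disjoint_singleton_left]
        exact fun hh => Set.disjoint_left.1 dS hx hh
      · rw [Set.disjoint_left]
        rintro k ⟨_, hk⟩ ⟨x, hx, hxk⟩
        exact hk x hx hxk
  have hpast : {k | n < G.comp k} = {k | ∃ x ∈ S, G.arrow x k} ∪
      {k | n < G.comp k ∧ ∀ x ∈ S, ¬ G.arrow x k} := by
    ext k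
    simp only [Set.mem_union, Set.mem_setOf_eq]
    constructor
    · intro hk
      by_cases h : ∃ x ∈ S, G.arrow x k
      · exact Or.inl h
      · push Not at h
        exact Or.inr ⟨hk, h⟩
    · rintro (⟨x, hx, hk⟩ | hk)
      · have := (harr _ _ hk).2
        have := (hS x hx).2
        omega
      · exact hk.1
  have dp : ∀ U : Set N, (∀ x ∈ U, ¬ G.isContext x ∧ G.comp x = n) →
      Disjoint U {k | n < G.comp k} := by
    intro U hU
    rw [Set.disjoint_left]
    intro x hx hk
    have := (hU x hx).2
    simp at hk
    omega
  have h2 : J P S T {k | n < G.comp k} := by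
    refine J.compAll hP hcomp (dp S hS) fun y hy => ?_
    refine (J.compAll hP hcomp ?_ fun x hx => ?_).symm
    · exact (dp T hT).mono_left (by simpa using hy)
    · have hne : x ≠ y := by rintro rfl; exact Set.disjoint_left.1 hST hx hy
      have := hpm.1 x y hne (hS x hx).1 (hT y hy).1 (by rw [(hS x hx).2, (hT y hy).2])
        (hd x hx y hy)
      have e : pastOf G x = {k | n < G.comp k} := by
        unfold pastOf; rw [(hS x hx).2]
      rw [e] at this
      refine J.symm ⟨by simpa using hne, ?_, ?_, this⟩
      · exact (dp S hS).mono_left (by simpa using hx)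
      · exact (dp T hT).mono_left (by simpa using hy)
  exact J.contr hP h1 h2 hpast

/-- the part of `A` in the context or in components with index at least `n` -/
def Lev (G : RegressionGraph N) (A : Set N) (n : ℕ) : Set N :=
  {x | x ∈ A ∧ (G.isContext x ∨ n ≤ G.comp x)}

theorem pairwise_ctx (hP : IsProb P) (hpm : PairwiseMarkov G P) (hint : HasIntersection P)
    {A : Set N} (hfull : ∀ q p, q ∈ A → G.full q p → p ∈ A) {i k : N} (hi : G.isContext i)
    (hiA : i ∈ A) (hk : G.isContext k) (hkA : k ∈ A) (hik : i ≠ k) (hn : ¬ G.full i k) :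
    J P {i} {k} ({x | x ∈ A ∧ G.isContext x} \ {i, k}) := by
  refine (ctx_local hpm hint hi).mono hP (le_refl _) ?_ ?_ ?_ ?_ ?_
  · simp; exact ⟨hk, Ne.symm hik, hn⟩
  · intro x hx
    have hx : G.full i x := hx
    have := G.full_ne _ _ hx
    refine ⟨⟨hfull _ _ hiA hx, (G.full_ctx _ _ hx).2.1⟩, ?_⟩
    rintro (rfl | h)
    · exact this rfl
    · have h : x = k := h
      subst h; exact hn hx
  · rintro x ⟨⟨_, hx⟩, hx'⟩
    simp only [Set.mem_union, Set.mem_setOf_eq, Set.mem_singleton_iff, Set.mem_insert_iff] at *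
    tauto
  · simp
  · simp

theorem pairwise_lev (hP : IsProb P) (hpm : PairwiseMarkov G P) (hint : HasIntersection P)
    (hcomp : HasComposition P) {A : Set N} (hfull : ∀ q p, q ∈ A → G.full q p → p ∈ A)
    (harrow : ∀ q p, q ∈ A → G.arrow q p → p ∈ A) {n : ℕ}
    (IH : ∀ i k, i ∈ Lev G A (n + 1) → k ∈ Lev G A (n + 1) → i ≠ k → ¬ CC G A i k →
      J P {i} {k} (Lev G A (n + 1) \ {i, k})) :
    ∀ i k, i ∈ Lev G A n → k ∈ Lev G A n → i ≠ k → ¬ CC G A i k →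
      J P {i} {k} (Lev G A n \ {i, k}) := by
  set B := Lev G A (n + 1) with hB
  let R : Set N := {x | x ∈ A ∧ ¬ G.isContext x ∧ G.comp x = n}
  have hlev : Lev G A n = R ∪ B := by
    ext x
    simp only [hB, R, Lev, Set.mem_union, Set.mem_setOf_eq]
    constructor
    · rintro ⟨h1, h2⟩
      by_cases hx : G.isContext x
      · exact Or.inr ⟨h1, Or.inl hx⟩
      · by_cases hc : G.comp x = n
        · exact Or.inl ⟨h1, hx, hc⟩
        · refine Or.inr ⟨h1, Or.inr ?_⟩
          have := h2.resolve_left hx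
          omega
    · rintro (⟨h1, h2, h3⟩ | ⟨h1, h2⟩)
      · exact ⟨h1, Or.inr (by omega)⟩
      · exact ⟨h1, h2.imp id (fun h => by omega)⟩
  have hRB : Disjoint R B := by
    rw [Set.disjoint_left]
    rintro x ⟨_, h1, h2⟩ ⟨_, h3 | h3⟩
    · exact h1 h3
    · omega
  have hRB' := Set.disjoint_left.1 hRB
  -- block statement with `B`
  have blockB : ∀ S : Set N, S ⊆ R → (∀ x ∈ S, ∀ y ∈ R, G.dashed x y → y ∈ S) →
      J P S ((R \ S) ∪ {k | k ∈ B ∧ ∀ x ∈ S, ¬ G.arrow x k}) {k | ∃ x ∈ S, G.arrow x k} := by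
    intro S hSR hcl
    rcases Set.eq_empty_or_nonempty S with rfl | ⟨x0, hx0⟩
    · refine J.symm (J.empty ?_)
      simp
    have h0 := block (G := G) (n := n) (S := S) (T := R \ S) hP hpm hint hcomp
      (fun x hx => (hSR hx).2) (fun x hx => hx.1.2) Set.disjoint_sdiff_right
      (fun x hx y hy hd => hy.2 (hcl x hx y hy.1 hd))
    have hctx : ∀ k, k ∈ B → n < G.comp k := by
      rintro k ⟨_, h | h⟩
      · have := G.context_last x0 k (hSR hx0).2.1 h
        rw [(hSR hx0).2.2] at this
        exact this
      · omega
    refine h0.mono1 hP ?_ (le_refl _) Set.subset_union_right ?_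
    · rintro k (hk | hk)
      · exact Or.inl hk
      · exact Or.inr ⟨hctx k hk.1, hk.2⟩
    · have := h0.2.2.1
      refine this.mono_left ?_
      rintro k (hk | hk)
      · exact Or.inl hk
      · exact Or.inr ⟨hctx k hk.1, hk.2⟩
  have parB : ∀ S : Set N, S ⊆ R → ∀ k, (∃ x ∈ S, G.arrow x k) → k ∈ B := by
    rintro S hS k ⟨x, hx, hxk⟩
    have h1 := hS hx
    refine ⟨harrow _ _ h1.1 hxk, Or.inr ?_⟩
    have := (G.arrow_resp _ _ hxk).2
    have := h1.2.2
    omega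
  -- first endpoint in `R`
  have caseR : ∀ i k, i ∈ R → k ∈ Lev G A n → i ≠ k → ¬ CC G A i k →
      J P {i} {k} (Lev G A n \ {i, k}) := by
    intro i k hi hk hik hcc
    rw [hlev] at hk ⊢
    let S : Set N := {x | x ∈ R ∧ Conn G A i x}
    have hSR : S ⊆ R := fun x hx => hx.1
    have h0 := blockB S hSR (by
      rintro x ⟨hx, hcx⟩ y hy hd
      exact ⟨hy, hcx.tail ⟨hd, hx.1, hy.1⟩⟩)
    have hiS : i ∈ S := ⟨hi, .refl⟩
    have hkS : k ∉ S := by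
      rintro ⟨h1, h2⟩
      exact hcc (Or.inr ⟨i, hi.1, k, h1.1, h2, Or.inl rfl, Or.inl rfl⟩)
    have hkpa : ∀ x ∈ S, ¬ G.arrow x k := by
      rintro x ⟨h1, h2⟩ h3
      exact hcc (Or.inr ⟨i, hi.1, x, h1.1, h2, Or.inl rfl, Or.inr h3⟩)
    refine h0.mono hP (by simpa using hiS) ?_ ?_ ?_ (by simp) (by simp)
    · simp only [Set.singleton_subset_iff]
      rcases hk with hk | hk
      · exact Or.inl ⟨hk, hkS⟩
      · exact Or.inr ⟨hk, hkpa⟩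
    · rintro z hz
      have hzB := parB S hSR z hz
      refine ⟨Or.inr hzB, ?_⟩
      rintro (rfl | h)
      · exact hRB' hi hzB
      · have h : z = k := h
        subst h
        obtain ⟨x, hx, hxz⟩ := hz
        exact hkpa x hx hxz
    · rintro z ⟨hz, _⟩
      by_cases hzS : z ∈ S
      · exact Or.inl (Or.inl hzS)
      by_cases hzp : ∃ x ∈ S, G.arrow x z
      · exact Or.inr hzp
      push Not at hzp
      rcases hz with hz | hz
      · exact Or.inl (Or.inr (Or.inl ⟨hz, hzS⟩))
      · exact Or.inl (Or.inr (Or.inr ⟨hz, hzp⟩))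
  intro i k hi hk hik hcc
  by_cases hiR : i ∈ R
  · exact caseR i k hiR hk hik hcc
  by_cases hkR : k ∈ R
  · have := (caseR k i hkR hi hik.symm (fun h => hcc (cc_symm G h))).symm
    rwa [Set.pair_comm] at this
  rw [hlev] at hi hk ⊢
  have hiB := hi.resolve_left hiR
  have hkB := hk.resolve_left hkR
  have h0 := IH i k hiB hkB hik hcc
  let T : Set N := {x | x ∈ R ∧ ∃ y ∈ R, Conn G A x y ∧ G.arrow y i}
  have hTR : T ⊆ R := fun x hx => hx.1
  have hkT : ∀ x ∈ T, ¬ G.arrow x k := by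
    rintro x ⟨hx, y, hy, hxy, hyi⟩ hxk
    exact hcc (Or.inr ⟨y, hy.1, x, hx.1, conn_symm G hxy, Or.inr hyi, Or.inr hxk⟩)
  have hiS : ∀ x ∈ R \ T, ¬ G.arrow x i := by
    rintro x ⟨hx, hxT⟩ hxi
    exact hxT ⟨hx, x, hx, .refl, hxi⟩
  have hT := blockB T hTR (by
    rintro x ⟨hx, z, hz, hxz, hzi⟩ y hy hd
    exact ⟨hy, z, hz, Relation.ReflTransGen.head ⟨G.dashed_symm _ _ hd, hy.1, hx.1⟩ hxz, hzi⟩)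
  have hS := blockB (R \ T) Set.diff_subset (by
    rintro x ⟨hx, hxT⟩ y hy hd
    refine ⟨hy, ?_⟩
    rintro ⟨_, z, hz, hyz, hzi⟩
    exact hxT ⟨hx, z, hz, Relation.ReflTransGen.head ⟨hd, hx.1, hy.1⟩ hyz, hzi⟩)
  have k1 : J P T {k} (B \ {k}) := by
    refine hT.mono hP (le_refl _) ?_ ?_ ?_ ?_ (by simp)
    · simp only [Set.singleton_subset_iff]; exact Or.inr ⟨hkB, hkT⟩
    · intro z hz
      refine ⟨parB T hTR z hz, ?_⟩
      intro h
      have h : z = k := h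
      subst h
      obtain ⟨x, hx, hxz⟩ := hz
      exact hkT x hx hxz
    · rintro z ⟨hz, _⟩
      by_cases hzp : ∃ x ∈ T, G.arrow x z
      · exact Or.inr hzp
      push Not at hzp
      exact Or.inl (Or.inr (Or.inr ⟨hz, hzp⟩))
    · exact (hRB.mono_left hTR).mono_right Set.diff_subset
  have k2 : J P {k} (T ∪ {i}) (B \ {i, k}) := by
    refine J.contr hP h0.symm k1.symm ?_
    ext x
    simp only [Set.mem_diff, Set.mem_union, Set.mem_singleton_iff, Set.mem_insert_iff]
    by_cases hx : x = i
    · subst hx; tauto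
    · tauto
  have k3 : J P {i} {k} (T ∪ B \ {i, k}) := by
    refine (k2.mono1 hP (by simp) Set.subset_union_right ?_ ?_).symm
    · intro x; simp only [Set.mem_diff, Set.mem_union, Set.mem_singleton_iff,
        Set.mem_insert_iff]; tauto
    · have : i ∉ T := fun h => hiR h.1
      simp [this]
  have k4 : J P {i} (R \ T) (T ∪ B \ {i}) := by
    refine (hS.mono hP (le_refl _) (b' := {i}) ?_ ?_ ?_ ?_ ?_).symm
    · simp only [Set.singleton_subset_iff]; exact Or.inr ⟨hiB, hiS⟩
    · intro z hz
      refine Or.inr ⟨parB (R \ T) Set.diff_subset z hz, ?_⟩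
      intro h
      have h : z = i := h
      subst h
      obtain ⟨x, hx, hxz⟩ := hz
      exact hiS x hx hxz
    · rintro z (hz | ⟨hz, _⟩)
      · exact Or.inl (Or.inr (Or.inl ⟨hTR hz, fun h => h.2 hz⟩))
      by_cases hzp : ∃ x ∈ R \ T, G.arrow x z
      · exact Or.inr hzp
      push Not at hzp
      exact Or.inl (Or.inr (Or.inr ⟨hz, hzp⟩))
    · rw [Set.disjoint_left]
      rintro z ⟨hz, hzT⟩ (h | h)
      · exact hzT h
      · exact hRB' hz h.1
    · have : i ∉ T := fun h => hiR h.1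
      simp [this]
  have k5 : J P {i} (R \ T ∪ {k}) (T ∪ B \ {i, k}) := by
    refine J.contr hP k3 k4 ?_
    ext x
    have : k ≠ i := hik.symm
    simp only [Set.mem_diff, Set.mem_union, Set.mem_singleton_iff, Set.mem_insert_iff]
    by_cases hx : x = k
    · subst hx; tauto
    · tauto
  refine k5.mono1 hP (by simp) ?_ ?_ (by simp)
  · rintro x (hx | hx)
    · refine ⟨Or.inl (hTR hx), ?_⟩
      rintro (rfl | h)
      · exact hiR (hTR hx)
      · have h : x = k := h
        subst h
        exact hkR (hTR hx)
    · exact ⟨Or.inr hx.1, hx.2⟩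
  · rintro x ⟨hx | hx, hx'⟩
    · by_cases hxT : x ∈ T
      · exact Or.inr (Or.inl hxT)
      · exact Or.inl (Or.inl ⟨hx, hxT⟩)
    · exact Or.inr (Or.inr ⟨hx, hx'⟩)

theorem pairwise_aug (hP : IsProb P) (hpm : PairwiseMarkov G P) (hint : HasIntersection P)
    (hcomp : HasComposition P) {A : Set N} (hfull : ∀ q p, q ∈ A → G.full q p → p ∈ A)
    (harrow : ∀ q p, q ∈ A → G.arrow q p → p ∈ A) (i k : N) (hi : i ∈ A) (hk : k ∈ A)
    (hik : i ≠ k) (hcc : ¬ CC G A i k) : J P {i} {k} (A \ {i, k}) := by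
  obtain ⟨M, hM⟩ : ∃ M, ∀ x : N, G.comp x < M :=
    ⟨Finset.univ.sup G.comp + 1, fun x => Nat.lt_succ_of_le (Finset.le_sup (Finset.mem_univ x))⟩
  have key : ∀ d n, n + d = M → ∀ i k, i ∈ Lev G A n → k ∈ Lev G A n → i ≠ k → ¬ CC G A i k →
      J P {i} {k} (Lev G A n \ {i, k}) := by
    intro d
    induction d with
    | zero =>
      intro n hn i k hi hk hik hcc
      have hx : ∀ x, x ∈ Lev G A n → x ∈ A ∧ G.isContext x := by
        rintro x ⟨h1, h2⟩
        refine ⟨h1, h2.resolve_right ?_⟩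
        have := hM x
        omega
      have e : Lev G A n = {x | x ∈ A ∧ G.isContext x} := by
        ext x
        exact ⟨hx x, fun h => ⟨h.1, Or.inl h.2⟩⟩
      rw [e]
      exact pairwise_ctx hP hpm hint hfull (hx i hi).2 (hx i hi).1 (hx k hk).2 (hx k hk).1 hik
        (fun h => hcc (Or.inl h))
    | succ d ih =>
      intro n hn
      exact pairwise_lev hP hpm hint hcomp hfull harrow (ih (n + 1) (by omega))
  have e : Lev G A 0 = A := by ext x; simp [Lev]
  have := key M 0 (by omega) i k (by rwa [e]) (by rwa [e]) hik hcc
  rwa [e] at this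

end Main

end GM

/-- **Global Markov property of a regression graph** (Sadeghi and Lauritzen, 2012).
If a probability distribution `P` on a finite product space satisfies the intersection
property, the composition property and all pairwise independences associated with the
missing edges of the regression graph `G`, then for all disjoint subsets `a`, `b`, `c`
of the node set: if there is no active path between `a` and `b` given `c` in `G`, then
`a ⫫ b | c` holds under `P`. -/
theorem global_markov_of_pairwise
    {N : Type} [Fintype N] [DecidableEq N] {X : N → Type} [∀ s, Fintype (X s)]
    (G : RegressionGraph N) (P : (∀ s, X s) → ℝ)
    (hP : IsProb P) (hpm : PairwiseMarkov G P)
    (hint : HasIntersection P) (hcomp : HasComposition P) :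
    ∀ a b c : Set N, Disjoint a b → Disjoint a c → Disjoint b c →
      G.ActivePathFree a b c → Indep P a b c := by
  intro a b c hab hac hbc hfree
  set A := GM.An G (a ∪ b ∪ c) with hA
  have hsub : a ∪ b ∪ c ⊆ A := GM.subset_An G _
  let D : Set N := {x | x ∈ A ∧ x ∉ c ∧ ∃ h, GM.Reach G a c A x h}
  have key : GM.J P D ((A \ c) \ D) c := by
    have e : D ∪ (A \ c) \ D ∪ c = A := by
      ext x
      have h1 : x ∈ c → x ∈ A := fun h => hsub (Or.inr h)
      have h2 : x ∈ D → x ∈ A := fun h => h.1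
      simp only [Set.mem_union, Set.mem_diff]
      tauto
    refine GM.J.interPairs hint Set.disjoint_sdiff_right ?_ ?_ ?_
    · rw [Set.disjoint_left]; exact fun x hx hc => hx.2.1 hc
    · rw [Set.disjoint_left]; exact fun x hx hc => hx.1.2 hc
    · intro i hi k hk
      rw [e]
      refine GM.pairwise_aug hP hpm hint hcomp (fun q p h1 h2 => GM.An_full G h1 h2)
        (fun q p h1 h2 => GM.An_arrow G h1 h2) i k hi.1 hk.1.1 ?_ ?_
      · rintro rfl; exact hk.2 hi
      · intro hcc
        exact hk.2 ⟨hk.1.1, hk.1.2, GM.reach_cc G hi.2.2 hi.1 hi.2.1 hcc⟩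
  have hbD : ∀ x ∈ b, x ∉ D := by
    rintro x hx ⟨_, _, h, hr⟩
    apply hfree
    have : ∃ y ∈ b, ∃ h, GM.Reach G a c (GM.An G c) y h := by
      rcases GM.weak_to_active G hr with h' | h'
      · exact h'
      · exact ⟨x, hx, h, h'⟩
    obtain ⟨y, hy, p, hp⟩ := this
    obtain ⟨f, m, ⟨w1, w2, w3, w4⟩, _⟩ := GM.walk_of_reach G hp
    have w3 : f m = y := w3
    exact GM.path_of_walk G hab ⟨m, f, w1, w2, by rw [w3]; exact hy, w4⟩
  refine (key.mono hP (a' := a) (b' := b) ?_ ?_ (le_refl _) Set.subset_union_right hac hbc).2.2.2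
  · intro x hx
    exact ⟨hsub (Or.inl (Or.inl hx)), Set.disjoint_left.1 hac hx, _, .start x hx⟩
  · intro x hx
    exact ⟨⟨hsub (Or.inl (Or.inr hx)), Set.disjoint_left.1 hbc hx⟩, hbD x hx⟩
end

section
/- Let N be a finite set and F a binary edge matrix on N. For all i, k in N, partial closure steps commute: zer_i (zer_k F) = zer_k (zer_i F). Consequently, for any subset a of N, the partial closure zer_a F, obtained by applying zer_i for the nodes i in a in any order, is well-defined (independent of the order). -/
/-- The single-node partial closure operator: `(zer_i F)_{jk} = 1` iff
`F_{jk} = 1` or (`F_{ji} = 1` and `F_{ik} = 1`). -/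
def zerStep {N : Type} (i : N) (F : N → N → Bool) : N → N → Bool :=
  fun j k => F j k || (F j i && F i k)

/-- Partial closure with respect to the nodes of a list, applied in order. -/
def zerList {N : Type} (l : List N) (F : N → N → Bool) : N → N → Bool :=
  l.foldr zerStep F

/-- Partial closure `zer_a F` with respect to a finite set `a` of nodes
(applying `zer_i` for the nodes `i ∈ a` in some enumeration). -/
noncomputable def zerFinset {N : Type} (a : Finset N) (F : N → N → Bool) : N → N → Bool :=
  zerList a.toList F

/-- **Commutativity of partial closure.** For a binary edge matrix `F` on a finite
set `N` (ones on the diagonal), the partial closure steps commute: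
`zer_i (zer_k F) = zer_k (zer_i F)` for all `i, k`; consequently `zer_a F` is
well-defined: applying `zer_i` for the nodes `i` of `a` in any order gives the same
result (the fold over any two enumerations of `a`, i.e. any two lists that are
permutations of each other, coincide). -/
theorem zer_commutes {N : Type} [Fintype N] (F : N → N → Bool)
    (hF : ∀ i, F i i = true) :
    (∀ i k : N, zerStep i (zerStep k F) = zerStep k (zerStep i F)) ∧
    (∀ l₁ l₂ : List N, l₁.Perm l₂ → zerList l₁ F = zerList l₂ F) := by
  have comm : ∀ (G : N → N → Bool) (i k : N),
      zerStep i (zerStep k G) = zerStep k (zerStep i G) := by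
    intro G i k
    funext j m
    simp only [zerStep]
    cases G j m <;> cases G j i <;> cases G j k <;> cases G i m <;> cases G k m <;>
      cases G i k <;> cases G k i <;> cases G i i <;> cases G k k <;> rfl
  refine ⟨comm F, ?_⟩
  have key : ∀ l₁ l₂ : List N, l₁.Perm l₂ → zerList l₁ F = zerList l₂ F := by
    intro l₁ l₂ h
    induction h with
    | nil => rfl
    | cons x _ ih => exact congrArg (zerStep x) ih
    | swap x y l => exact comm (zerList l F) y x
    | trans _ _ ih₁ ih₂ => exact ih₁.trans ih₂
  exact key
end
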